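/- arXiv:2311.07266 — 5 statements merged into one kernel-verified Lean document; each statement's English description precedes it below -/
import Mathlib

section
/- With the notation of the n-qubit Hardy construction: the 2^n vectors consisting of φ₋ together with φ_x for all choice functions x : Fin n → {0,+} other than the all-+ choice 𝟏⁺ are linearly independent, and hence form a basis of the 2^n-dimensional Hilbert space H = EuclideanSpace ℂ (Fin n → Bool). -/
noncomputable section

namespace Hardy

/-- `|0⟩` : the indicator of `false`, identifying `ℂ²` with `Bool → ℂ`. -/
def ket0 : Bool → ℂ := fun t => if t then 0 else 1

/-- `|+⟩ = a·|0⟩ + b·|1⟩`. -/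
def ketP (a b : ℂ) : Bool → ℂ := fun t => if t then b else a

/-- `|−⟩ = conj b ·|0⟩ − conj a ·|1⟩`. -/
def ketM (a b : ℂ) : Bool → ℂ :=
  fun t => if t then -(starRingEnd ℂ a) else (starRingEnd ℂ b)

/-- The product vector `φ_x` for a choice function `x : Fin n → Bool`
(`x i = false` encodes the `0`-choice, `x i = true` the `+`-choice):
`φ_x (b) = ∏ i, cᵢ (b i)` with `cᵢ = |0⟩` if `x i = 0` and `cᵢ = |+⟩ᵢ` if `x i = +`. -/
def phi {n : ℕ} (α β : Fin n → ℂ) (x : Fin n → Bool) :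
    EuclideanSpace ℂ (Fin n → Bool) :=
  (WithLp.equiv 2 _).symm fun b =>
    ∏ i, (if x i then ketP (α i) (β i) (b i) else ket0 (b i))

/-- The product vector `φ₋ = |−⟩₁ ⊗ ⋯ ⊗ |−⟩ₙ`. -/
def phiMinus {n : ℕ} (α β : Fin n → ℂ) : EuclideanSpace ℂ (Fin n → Bool) :=
  (WithLp.equiv 2 _).symm fun b => ∏ i, ketM (α i) (β i) (b i)

/-- The subspace `S` spanned by `φ₋` together with the `φ_x` for all choice
functions `x ∉ {𝟎, 𝟏⁺}`. -/
def hardySpan {n : ℕ} (α β : Fin n → ℂ) :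
    Submodule ℂ (EuclideanSpace ℂ (Fin n → Bool)) :=
  Submodule.span ℂ
    ({phiMinus α β} ∪
      {v | ∃ x : Fin n → Bool,
        x ≠ (fun _ => false) ∧ x ≠ (fun _ => true) ∧ v = phi α β x})

end Hardy

open Hardy

/-- A family of functions on a partial order that is triangular with respect to an injective
indexing, with nonzero diagonal, is linearly independent. -/
theorem linearIndependent_of_triangular {K ι P : Type*} [Field K] [PartialOrder P]
    (v : ι → P → K) (e : ι → P) (he : Function.Injective e)
    (hdiag : ∀ i, v i (e i) ≠ 0) (htri : ∀ i p, v i p ≠ 0 → p ≤ e i) :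
    LinearIndependent K v := by
  classical
  rw [linearIndependent_iff']
  intro s c hc i hi
  by_contra hne
  let t := (s.filter fun j => c j ≠ 0).image e
  have ht : t.Nonempty := ⟨e i, Finset.mem_image_of_mem e (by simp [hi, hne])⟩
  obtain ⟨p, hp⟩ := t.exists_maximal ht
  obtain ⟨k, hk, rfl⟩ := Finset.mem_image.1 hp.prop
  obtain ⟨hks, hck⟩ := Finset.mem_filter.1 hk
  have hzero := congrFun hc (e k)
  simp only [Finset.sum_apply, Pi.smul_apply, smul_eq_mul, Pi.zero_apply] at hzero
  rw [Finset.sum_eq_single_of_mem k hks] at hzero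
  · exact mul_ne_zero hck (hdiag k) hzero
  · intro j hj hjk
    by_contra hmul
    obtain ⟨hcj, hvj⟩ := mul_ne_zero_iff.1 hmul
    have hle := htri j (e k) hvj
    have hjt : e j ∈ t := Finset.mem_image_of_mem e (by simp [hj, hcj])
    exact hjk (he (le_antisymm (hp.le_of_ge hjt hle) hle))

namespace Hardy

theorem phi_apply {n : ℕ} (α β : Fin n → ℂ) (x b : Fin n → Bool) :
    phi α β x b = ∏ i, (if x i then ketP (α i) (β i) (b i) else ket0 (b i)) :=
  rfl

theorem phiMinus_apply {n : ℕ} (α β : Fin n → ℂ) (b : Fin n → Bool) :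
    phiMinus α β b = ∏ i, ketM (α i) (β i) (b i) :=
  rfl

theorem phi_apply_self_ne_zero {n : ℕ} {α β : Fin n → ℂ} (hβ : ∀ i, β i ≠ 0)
    (x : Fin n → Bool) : phi α β x x ≠ 0 := by
  rw [phi_apply, Finset.prod_ne_zero_iff]
  intro i _
  cases h : x i <;> simp [ketP, ket0, hβ]

theorem le_of_phi_apply_ne_zero {n : ℕ} {α β : Fin n → ℂ} {x b : Fin n → Bool}
    (h : phi α β x b ≠ 0) : b ≤ x := by
  rw [phi_apply, Finset.prod_ne_zero_iff] at h
  intro i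
  have hi := h i (Finset.mem_univ i)
  cases hx : x i <;> cases hb : b i <;> simp_all [ket0]

theorem phiMinus_apply_true_ne_zero {n : ℕ} {α β : Fin n → ℂ} (hα : ∀ i, α i ≠ 0) :
    phiMinus α β (fun _ => true) ≠ 0 := by
  rw [phiMinus_apply, Finset.prod_ne_zero_iff]
  intro i _
  simp [ketM, hα]

end Hardy

/-- **The 2ⁿ vectors φ₋ and φ_x (x ≠ 𝟏⁺) are linearly independent and span H.**
Indexing them by `Option {x // x ≠ 𝟏⁺}` (`none ↦ φ₋`, `some x ↦ φ_x`), the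
family is linearly independent, and hence forms a basis of the
`2ⁿ`-dimensional Hilbert space `H = EuclideanSpace ℂ (Fin n → Bool)`. -/
theorem phi_family_linearIndependent_and_spans (n : ℕ) (α β : Fin n → ℂ)
    (hnorm : ∀ j, ‖α j‖ ^ 2 + ‖β j‖ ^ 2 = 1)
    (hα : ∀ j, 0 < ‖α j‖ ∧ ‖α j‖ < 1) :
    LinearIndependent ℂ
        (fun v : Option {x : Fin n → Bool // x ≠ fun _ => true} =>
          Option.elim v (phiMinus α β) (fun x => phi α β x.1)) ∧
      Submodule.span ℂ
          (Set.range
            (fun v : Option {x : Fin n → Bool // x ≠ fun _ => true} =>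
              Option.elim v (phiMinus α β) (fun x => phi α β x.1))) = ⊤ := by
  have hα₀ : ∀ i, α i ≠ 0 := fun i => norm_pos_iff.1 (hα i).1
  have hβ₀ : ∀ i, β i ≠ 0 := by
    intro i hi
    have h := hnorm i
    rw [hi] at h
    simp only [norm_zero] at h
    nlinarith [hα i]
  let e := Equiv.optionSubtypeNe (fun _ : Fin n => true)
  have hli : LinearIndependent ℂ
      (fun v : Option {x : Fin n → Bool // x ≠ fun _ => true} =>
        Option.elim v (phiMinus α β) (fun x => phi α β x.1)) := by
    refine LinearIndependent.of_comp
      (WithLp.linearEquiv 2 ℂ ((Fin n → Bool) → ℂ)).toLinearMap ?_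
    refine linearIndependent_of_triangular _ e e.injective ?_ ?_
    · rintro (_ | x)
      · exact phiMinus_apply_true_ne_zero hα₀
      · exact phi_apply_self_ne_zero hβ₀ x.1
    · rintro (_ | x) b h
      · exact fun i => Bool.le_true (b i)
      · exact le_of_phi_apply_ne_zero h
  refine ⟨hli, hli.span_eq_top_of_card_eq_finrank ?_⟩
  rw [finrank_euclideanSpace, Fintype.card_congr e]
end
end

section
/- With the notation of the n-qubit Hardy construction (n ≥ 2): a vector ψ ∈ H is orthogonal to S if and only if ψ satisfies all the Hardy zero-conditions in the following sense: (a) ⟨ψ, φ₋⟩ = 0, and (b) for every i ∈ Fin n and every family of vectors u_j ∈ Bool → ℂ for j ∉ {i, i+1} (index i+1 cyclic in Fin n), ψ is orthogonal to the product vector w given by w(b) = (|+⟩_i at b i) · (|0⟩ at b (i+1)) · ∏_{j ∉ {i,i+1}} u_j(b j). Here S is the linear span of φ₋ together with all φ_x for choice functions x : Fin n → {0,+} with x ∉ {𝟎, 𝟏⁺}. -/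
noncomputable section

namespace Hardy

/-- The product vector with local factors `c i`. -/
def prodVec {n : ℕ} (c : Fin n → Bool → ℂ) : EuclideanSpace ℂ (Fin n → Bool) :=
  (WithLp.equiv 2 _).symm fun b => ∏ i, c i (b i)

/-- The local vector of party `i` selected by a choice in `{0, +}`. -/
def ketChoice {n : ℕ} (α β : Fin n → ℂ) (i : Fin n) (y : Bool) : Bool → ℂ :=
  if y then ketP (α i) (β i) else ket0

lemma phi_eq_prodVec {n : ℕ} (α β : Fin n → ℂ) (x : Fin n → Bool) :
    phi α β x = prodVec fun i => ketChoice α β i (x i) := by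
  simp only [phi, prodVec, ketChoice, ite_apply]

lemma prodVec_sum {n : ℕ} (a : Fin n → Bool → ℂ) (e : Fin n → Bool → Bool → ℂ) :
    prodVec (fun i t => ∑ y, a i y * e i y t) =
      ∑ x : Fin n → Bool, (∏ i, a i (x i)) • prodVec fun i => e i (x i) := by
  ext b
  simp [prodVec, WithLp.ofLp_sum, -Fintype.univ_bool,
    Finset.prod_univ_sum, Finset.prod_mul_distrib]

lemma exists_ketChoice_coeff {n : ℕ} {α β : Fin n → ℂ} (hβ : ∀ j, β j ≠ 0) (j : Fin n)
    (u : Bool → ℂ) : ∃ a : Bool → ℂ, u = fun t => ∑ y, a y * ketChoice α β j y t := by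
  refine ⟨fun y => if y then u true / β j else u false - u true / β j * α j, ?_⟩
  funext t
  have := hβ j
  cases t <;> simp [ketChoice, ketP, ket0, this]

lemma prodVec_eq_of_pair {n : ℕ} (c : Fin n → Bool → ℂ) {i k : Fin n} (hik : i ≠ k) :
    prodVec c = (WithLp.equiv 2 _).symm fun b : Fin n → Bool =>
      c i (b i) * c k (b k) * ∏ j ∈ Finset.univ \ {i, k}, c j (b j) := by
  unfold prodVec
  congr 1
  funext b
  rw [← Finset.prod_sdiff (Finset.subset_univ {i, k}), Finset.prod_pair hik, mul_comm]

lemma prodVec_mem_hardySpan {n : ℕ} {α β : Fin n → ℂ} (hβ : ∀ j, β j ≠ 0)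
    (c : Fin n → Bool → ℂ) {i k : Fin n} (hi : c i = ketP (α i) (β i)) (hk : c k = ket0) :
    prodVec c ∈ hardySpan α β := by
  have hcoeff : ∀ j, ∃ a : Bool → ℂ, (c j = fun t => ∑ y, a y * ketChoice α β j y t) ∧
      (j = i → a false = 0) ∧ (j = k → a true = 0) := by
    intro j
    obtain ⟨a, ha⟩ := exists_ketChoice_coeff (α := α) hβ j (c j)
    refine ⟨a, ha, ?_, ?_⟩
    · rintro rfl
      have h0 := congrFun (hi.symm.trans ha) false
      have h1 := congrFun (hi.symm.trans ha) true
      simp only [Fintype.sum_bool, ketChoice, ketP, ket0, if_true, Bool.false_eq_true, if_false,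
        mul_zero, add_zero, mul_one] at h0 h1
      have : a true = 1 := mul_right_cancel₀ (hβ j) (by rw [one_mul]; exact h1.symm)
      simpa [this] using h0
    · rintro rfl
      have h1 := congrFun (hk.symm.trans ha) true
      simpa [ketChoice, ketP, ket0, hβ j] using h1
  choose a ha hai hak using hcoeff
  rw [funext ha, prodVec_sum]
  refine Submodule.sum_mem _ fun x _ => ?_
  by_cases hx0 : x = fun _ => false
  · rw [Finset.prod_eq_zero (Finset.mem_univ i) (by rw [hx0]; exact hai i rfl), zero_smul]
    exact Submodule.zero_mem _
  by_cases hx1 : x = fun _ => true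
  · rw [Finset.prod_eq_zero (Finset.mem_univ k) (by rw [hx1]; exact hak k rfl), zero_smul]
    exact Submodule.zero_mem _
  exact Submodule.smul_mem _ _
    (Submodule.subset_span (Or.inr ⟨x, hx0, hx1, (phi_eq_prodVec α β x).symm⟩))

lemma exists_true_succ_false {n : ℕ} (hn : 1 < n) {x : Fin n → Bool}
    (h0 : x ≠ fun _ => false) (h1 : x ≠ fun _ => true) :
    ∃ i, x i = true ∧ x (i + ⟨1, hn⟩) = false := by
  by_contra! h
  obtain ⟨i, hi⟩ := Function.ne_iff.mp h0
  have hpos : 0 < n := by omega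
  have key (k : ℕ) : x ⟨(i + k) % n, Nat.mod_lt _ hpos⟩ = true := by
    induction k with
    | zero => simpa [Nat.mod_eq_of_lt i.isLt] using hi
    | succ k ih =>
      have hs := h _ ih
      rw [Ne, Bool.not_eq_false] at hs
      rw [← hs]
      congr 1
      ext
      simp [Fin.val_add, Nat.add_assoc]
  refine h1 (funext fun j => ?_)
  rw [← key (j + n - i)]
  congr 1
  ext
  have : (i : ℕ) + (j + n - i) = j + n := by omega
  simp [this, Nat.mod_eq_of_lt j.isLt]

lemma ne_add_one {n : ℕ} (hn : 1 < n) (i : Fin n) : i ≠ i + ⟨1, hn⟩ := by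
  have : NeZero n := ⟨by omega⟩
  intro h
  simpa [Fin.ext_iff] using left_eq_add.mp h

end Hardy

open Hardy

/-- **Orthogonality to S ⟺ the Hardy zero-conditions.**
For `n ≥ 2`, a vector `ψ ∈ H` is orthogonal to `S = hardySpan α β` if and only
if (a) `⟨ψ, φ₋⟩ = 0` and (b) for every `i ∈ Fin n` (index `i+1` cyclic) and
every family `u : Fin n → (Bool → ℂ)`, `ψ` is orthogonal to the product vector
`w (b) = |+⟩ᵢ(b i) · |0⟩(b (i+1)) · ∏_{j ∉ {i, i+1}} u j (b j)`. -/
theorem mem_orthogonal_hardySpan_iff (n : ℕ) (hn : 2 ≤ n) (α β : Fin n → ℂ)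
    (hnorm : ∀ j, ‖α j‖ ^ 2 + ‖β j‖ ^ 2 = 1)
    (hα : ∀ j, 0 < ‖α j‖ ∧ ‖α j‖ < 1)
    (ψ : EuclideanSpace ℂ (Fin n → Bool)) :
    ψ ∈ (hardySpan α β)ᗮ ↔
      (inner ℂ ψ (phiMinus α β) = (0 : ℂ) ∧
        ∀ i : Fin n, ∀ u : Fin n → Bool → ℂ,
          inner ℂ ψ
            ((WithLp.equiv 2 _).symm fun b : Fin n → Bool =>
              ketP (α i) (β i) (b i) *
                ket0 (b (i + ⟨1, by omega⟩)) *
                  ∏ j ∈ Finset.univ \ {i, i + ⟨1, by omega⟩}, u j (b j)) = (0 : ℂ)) := by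
  have hβ : ∀ j, β j ≠ 0 := by
    intro j hj
    have h := hnorm j
    rw [hj, norm_zero] at h
    nlinarith [hα j]
  rw [Submodule.mem_orthogonal']
  constructor
  · intro h
    refine ⟨h _ (Submodule.subset_span (Or.inl rfl)), fun i u => ?_⟩
    have hik := ne_add_one hn i
    set k : Fin n := i + ⟨1, by omega⟩
    let c : Fin n → Bool → ℂ :=
      Function.update (Function.update u k ket0) i (ketP (α i) (β i))
    have hi : c i = ketP (α i) (β i) := Function.update_self ..
    have hk : c k = ket0 := by simp [c, hik.symm]
    refine Eq.trans (congrArg (inner ℂ ψ) ?_) (h _ (prodVec_mem_hardySpan hβ c hi hk))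
    rw [prodVec_eq_of_pair c hik, hi, hk]
    congr 1
    funext b
    congr 1
    refine Finset.prod_congr rfl fun j hj => ?_
    simp only [Finset.mem_sdiff, Finset.mem_insert, Finset.mem_singleton, not_or] at hj
    simp [c, hj.2.1, hj.2.2]
  · rintro ⟨hminus, h⟩
    suffices hardySpan α β ≤ (Submodule.span ℂ {ψ})ᗮ from fun v hv =>
      Submodule.mem_orthogonal_singleton_iff_inner_right.mp (this hv)
    refine Submodule.span_le.mpr ?_
    rintro v (rfl | ⟨x, hx0, hx1, rfl⟩) <;>
      refine Submodule.mem_orthogonal_singleton_iff_inner_right.mpr ?_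
    · exact hminus
    · obtain ⟨i, hi, hk⟩ := exists_true_succ_false hn hx0 hx1
      refine Eq.trans (congrArg (inner ℂ ψ) ?_) (h i fun j => ketChoice α β j (x j))
      rw [phi_eq_prodVec, prodVec_eq_of_pair _ (ne_add_one hn i), hi, hk]
      rfl
end
end

section
/- With the notation of the n-qubit Hardy construction (n ≥ 2): every nonzero vector ψ ∈ H orthogonal to S is genuinely multipartite entangled; that is, for every subset A ⊆ Fin n with A ≠ ∅ and A ≠ Fin n, there do NOT exist functions f : (A → Bool) → ℂ and g : ((Fin n \ A) → Bool) → ℂ such that ψ(b) = f(b restricted to A) · g(b restricted to Fin n \ A) for all b : Fin n → Bool. Here S is the linear span of φ₋ together with all φ_x for choice functions x : Fin n → {0,+} with x ∉ {𝟎, 𝟏⁺}. -/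
noncomputable section

open Hardy

namespace Hardy

variable {ι : Type*} [Fintype ι] [DecidableEq ι]

/-- The inner product of the product vector `⨂ i, v i` with `ψ`. -/
def overlap (v : ι → Bool → ℂ) (ψ : (ι → Bool) → ℂ) : ℂ :=
  ∑ b, starRingEnd ℂ (∏ i, v i (b i)) * ψ b

/-- The two local choices: `|0⟩` for `false` and `|+⟩` for `true`. -/
def localKet (a b : ℂ) (t : Bool) : Bool → ℂ :=
  fun s => if t then ketP a b s else ket0 s

/-- Exchanging the coordinates in `A` between two configurations. -/
def exchange (A : Set ι) [DecidablePred (· ∈ A)] :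
    Equiv.Perm ((ι → Bool) × (ι → Bool)) :=
  Function.Involutive.toPerm (fun p => (A.piecewise p.2 p.1, A.piecewise p.1 p.2)) <| by
    rintro ⟨b, b'⟩
    ext i <;> by_cases hi : i ∈ A <;> simp [hi]

/-- If the amplitudes of `ψ` are invariant under exchanging the coordinates in `A`,
so are its overlaps with product vectors. -/
theorem overlap_mul_overlap_piecewise (A : Set ι) [DecidablePred (· ∈ A)]
    (ψ : (ι → Bool) → ℂ)
    (hψ : ∀ b b', ψ b * ψ b' = ψ (A.piecewise b' b) * ψ (A.piecewise b b'))
    (v w : ι → Bool → ℂ) :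
    overlap v ψ * overlap w ψ =
      overlap (A.piecewise w v) ψ * overlap (A.piecewise v w) ψ := by
  simp only [overlap, Finset.sum_mul_sum, ← Fintype.sum_prod_type']
  refine Fintype.sum_equiv (exchange A) _ _ ?_
  rintro ⟨b, b'⟩
  have hprod : (∏ i, v i (b i)) * ∏ i, w i (b' i) =
      (∏ i, A.piecewise w v i (A.piecewise b' b i)) *
        ∏ i, A.piecewise v w i (A.piecewise b b' i) := by
    rw [← Finset.prod_mul_distrib, ← Finset.prod_mul_distrib]
    refine Finset.prod_congr rfl fun i _ => ?_
    by_cases hi : i ∈ A <;> simp [hi, mul_comm]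
  change _ = starRingEnd ℂ (∏ i, A.piecewise w v i (A.piecewise b' b i)) *
      ψ (A.piecewise b' b) *
    (starRingEnd ℂ (∏ i, A.piecewise v w i (A.piecewise b b' i)) * ψ (A.piecewise b b'))
  rw [mul_mul_mul_comm, ← map_mul, hprod, hψ b b', map_mul, mul_mul_mul_comm]

/-- Multilinear expansion of an overlap with a product vector. -/
theorem overlap_eq_sum (ψ : (ι → Bool) → ℂ) (v : ι → Bool → ℂ) (k : ι → Bool → Bool → ℂ)
    (a : ι → Bool → ℂ) (h : ∀ i s, v i s = ∑ t, a i t * k i t s) :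
    overlap v ψ =
      ∑ x : ι → Bool, starRingEnd ℂ (∏ i, a i (x i)) * overlap (fun i => k i (x i)) ψ := by
  simp only [overlap, Finset.mul_sum]
  rw [Finset.sum_comm]
  refine Finset.sum_congr rfl fun b _ => ?_
  simp only [h, Fintype.prod_sum, Finset.prod_mul_distrib, map_sum, map_mul, Finset.sum_mul,
    mul_assoc]

theorem overlap_indicator (ψ : (ι → Bool) → ℂ) (b : ι → Bool) :
    overlap (fun i s => if s = b i then 1 else 0) ψ = ψ b := by
  rw [overlap, Finset.sum_eq_single b]
  · simp
  · intro b' _ hb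
    obtain ⟨i, hi⟩ := Function.ne_iff.mp hb
    rw [Finset.prod_eq_zero (Finset.mem_univ i) (by simp [hi])]
    simp
  · simp

/-- A vector orthogonal to all products of `|0⟩` and `|+⟩` vanishes. -/
theorem eq_zero_of_overlap_localKet (α β : ι → ℂ) (hβ : ∀ i, β i ≠ 0)
    (ψ : (ι → Bool) → ℂ)
    (h : ∀ x : ι → Bool, overlap (fun i => localKet (α i) (β i) (x i)) ψ = 0) : ψ = 0 := by
  funext b
  rw [← overlap_indicator ψ b, overlap_eq_sum ψ _ (fun i => localKet (α i) (β i))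
    (fun i t => if t then (if b i then (β i)⁻¹ else 0)
      else (if b i then -(α i) * (β i)⁻¹ else 1))]
  · simp [h]
  · intro i s
    have := hβ i
    cases hb : b i <;> cases s <;> simp [localKet, ketP, ket0, this, mul_comm]

/-- A vector orthogonal to `⨂ |−⟩` and to all but one of the products of `|0⟩` and `|+⟩`
is orthogonal to all these products. -/
theorem overlap_localKet_eq_zero_of_ne (α β : ι → ℂ) (hα : ∀ i, α i ≠ 0) (hβ : ∀ i, β i ≠ 0)
    (hnorm : ∀ i, ‖α i‖ ^ 2 + ‖β i‖ ^ 2 = 1) (ψ : (ι → Bool) → ℂ)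
    (hminus : overlap (fun i => ketM (α i) (β i)) ψ = 0) (x₀ : ι → Bool)
    (h : ∀ x, x ≠ x₀ → overlap (fun i => localKet (α i) (β i) (x i)) ψ = 0) :
    overlap (fun i => localKet (α i) (β i) (x₀ i)) ψ = 0 := by
  rw [overlap_eq_sum ψ _ (fun i => localKet (α i) (β i))
    (fun i t => if t then -(starRingEnd ℂ (α i)) * (β i)⁻¹ else (β i)⁻¹)] at hminus
  · rw [Finset.sum_eq_single x₀ (fun x _ hx => by rw [h x hx, mul_zero]) (by simp)] at hminus
    refine (mul_eq_zero.mp hminus).resolve_left ?_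
    refine (map_ne_zero _).mpr (Finset.prod_ne_zero_iff.mpr fun i _ => ?_)
    cases x₀ i <;> simp [hα, hβ]
  · intro i s
    have hb := hβ i
    have hn : α i * starRingEnd ℂ (α i) + β i * starRingEnd ℂ (β i) = 1 := by
      rw [Complex.mul_conj', Complex.mul_conj']
      exact_mod_cast hnorm i
    cases s
    · simp only [ketM, localKet, ketP, ket0, Fintype.sum_bool, Bool.false_eq_true, if_true,
        if_false]
      field_simp
      linear_combination hn
    · simp [ketM, localKet, ketP, ket0, hb]

theorem inner_eq_overlap (v : ι → Bool → ℂ) (ψ : EuclideanSpace ℂ (ι → Bool)) :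
    inner ℂ ((WithLp.equiv 2 _).symm fun b => ∏ i, v i (b i)) ψ =
      overlap v (WithLp.equiv 2 _ ψ) := by
  simp [PiLp.inner_apply, overlap, mul_comm]

end Hardy

/-- **Every nonzero vector orthogonal to S is genuinely multipartite entangled.**
For `n ≥ 2`, if `ψ ∈ Sᗮ` is nonzero, then for every nontrivial bipartition
`A | Aᶜ` of the parties, `ψ` does not factor as a product of a state of the
parties in `A` and a state of the parties in `Aᶜ`. -/
theorem hardy_state_genuinely_entangled (n : ℕ) (hn : 2 ≤ n) (α β : Fin n → ℂ)
    (hnorm : ∀ j, ‖α j‖ ^ 2 + ‖β j‖ ^ 2 = 1)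
    (hα : ∀ j, 0 < ‖α j‖ ∧ ‖α j‖ < 1)
    (ψ : EuclideanSpace ℂ (Fin n → Bool))
    (hmem : ψ ∈ (hardySpan α β)ᗮ) (hψ : ψ ≠ 0)
    (A : Set (Fin n)) (hA₁ : A ≠ ∅) (hA₂ : A ≠ Set.univ) :
    ¬ ∃ (f : (↥A → Bool) → ℂ) (g : (↥Aᶜ → Bool) → ℂ),
        ∀ b : Fin n → Bool,
          (WithLp.equiv 2 _) ψ b =
            f (fun i : ↥A => b ↑i) * g (fun i : ↥Aᶜ => b ↑i) := by
  classical
  rintro ⟨f, g, hfg⟩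
  have hα0 : ∀ j, α j ≠ 0 := fun j => norm_pos_iff.mp (hα j).1
  have hβ0 : ∀ j, β j ≠ 0 := by
    intro j hj
    have h1 := hnorm j
    rw [hj, norm_zero] at h1
    nlinarith [hα j]
  set Ψ : (Fin n → Bool) → ℂ := WithLp.equiv 2 _ ψ with hΨ
  have hminus : overlap (fun i => ketM (α i) (β i)) Ψ = 0 := by
    rw [hΨ, ← inner_eq_overlap]
    exact (Submodule.mem_orthogonal _ _).mp hmem _ (Submodule.subset_span (Or.inl rfl))
  have hphi : ∀ x : Fin n → Bool, x ≠ (fun _ => false) → x ≠ (fun _ => true) →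
      overlap (fun i => localKet (α i) (β i) (x i)) Ψ = 0 := by
    intro x h0 h1
    rw [hΨ, ← inner_eq_overlap]
    exact (Submodule.mem_orthogonal _ _).mp hmem _
      (Submodule.subset_span (Or.inr ⟨x, h0, h1, rfl⟩))
  have hexch : ∀ b b', Ψ b * Ψ b' = Ψ (A.piecewise b' b) * Ψ (A.piecewise b b') := by
    intro b b'
    have hin : ∀ c d : Fin n → Bool, (fun i : A => A.piecewise c d i) = fun i : A => c i :=
      fun c d => funext fun i => Set.piecewise_eq_of_mem _ _ _ i.2
    have hout : ∀ c d : Fin n → Bool,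
        (fun i : ↥Aᶜ => A.piecewise c d i) = fun i : ↥Aᶜ => d i :=
      fun c d => funext fun i => Set.piecewise_eq_of_notMem _ _ _ i.2
    simp only [hfg, hin, hout]
    ring
  obtain ⟨i, hi⟩ := Set.nonempty_iff_ne_empty.mpr hA₁
  obtain ⟨j, hj⟩ := (Set.ne_univ_iff_exists_notMem A).mp hA₂
  have hmixed : overlap (fun i => localKet (α i) (β i) false) Ψ *
      overlap (fun i => localKet (α i) (β i) true) Ψ = 0 := by
    rw [overlap_mul_overlap_piecewise A Ψ hexch]
    refine mul_eq_zero_of_left ?_ _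
    have hx := hphi (fun k => decide (k ∈ A))
      (fun h => by simpa [hi] using congrFun h i) (fun h => by simpa [hj] using congrFun h j)
    convert hx using 2
    funext k
    by_cases hk : k ∈ A <;> simp [hk]
  have hzero : ∀ x : Fin n → Bool, overlap (fun i => localKet (α i) (β i) (x i)) Ψ = 0 := by
    obtain ⟨x₀, hx₀⟩ : ∃ x₀ : Fin n → Bool, ∀ x, x ≠ x₀ →
        overlap (fun i => localKet (α i) (β i) (x i)) Ψ = 0 := by
      rcases mul_eq_zero.mp hmixed with h | h
      · refine ⟨fun _ => true, fun x hx => ?_⟩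
        by_cases h0 : x = fun _ => false
        · rw [h0]; exact h
        · exact hphi x h0 hx
      · refine ⟨fun _ => false, fun x hx => ?_⟩
        by_cases h1 : x = fun _ => true
        · rw [h1]; exact h
        · exact hphi x hx h1
    intro x
    by_cases hx : x = x₀
    · rw [hx]
      exact overlap_localKet_eq_zero_of_ne α β hα0 hβ0 hnorm Ψ hminus x₀ hx₀
    · exact hx₀ x hx
  have hΨ0 := eq_zero_of_overlap_localKet α β hβ0 Ψ hzero
  exact hψ ((WithLp.equiv 2 _).injective hΨ0)
end
end

section
/- With the notation of the n-qubit Hardy construction: let ρ be a positive semidefinite ℂ-matrix indexed by (Fin n → Bool), and suppose that vᴴ ρ v = 0 (equivalently, Tr(ρ · v vᴴ) = 0) for every vector v in the generating set of S, namely v = φ₋ and v = φ_x for every choice function x : Fin n → {0,+} with x ∉ {𝟎, 𝟏⁺}. Let ψ be a unit vector orthogonal to S. Then ρ = c · (ψ ψᴴ) for some real c ≥ 0 (namely c = Tr ρ); in particular, every density matrix satisfying the Hardy zero-conditions is the pure state determined by ψ. -/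
noncomputable section

open Hardy Matrix ComplexOrder

namespace Hardy

/-- A product vector is the combination of the `φ_x` obtained by expanding each factor in the
basis `|0⟩, |+⟩ᵢ`. -/
theorem prod_eq_sum_phi {n : ℕ} {α β : Fin n → ℂ} (hβ : ∀ j, β j ≠ 0) (c : Fin n → Bool → ℂ) :
    WithLp.toLp 2 (fun b : Fin n → Bool => ∏ i, c i (b i)) =
      ∑ x : Fin n → Bool,
        (∏ i, if x i then c i true / β i else c i false - α i * (c i true / β i)) •
          phi α β x := by
  ext b
  have hfactor : ∀ i, c i (b i) =
      ∑ t : Bool, (if t then c i true / β i else c i false - α i * (c i true / β i)) *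
        (if t then ketP (α i) (β i) (b i) else ket0 (b i)) := by
    intro i
    have := hβ i
    cases h : b i
    · simp [ketP, ket0]; ring
    · simp [ketP, ket0]; field_simp
  simp only [WithLp.ofLp_sum, Finset.sum_apply, WithLp.ofLp_smul, Pi.smul_apply, smul_eq_mul, phi,
    WithLp.equiv_symm_apply]
  rw [Finset.prod_congr rfl fun i _ => hfactor i, Fintype.prod_sum]
  exact Finset.sum_congr rfl fun x _ => Finset.prod_mul_distrib

/-- A vector orthogonal to every `φ_x` vanishes. -/
theorem eq_zero_of_inner_phi_eq_zero {n : ℕ} {α β : Fin n → ℂ} (hβ : ∀ j, β j ≠ 0)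
    {u : EuclideanSpace ℂ (Fin n → Bool)} (hu : ∀ x, inner ℂ (phi α β x) u = 0) : u = 0 := by
  ext b
  have hsingle : EuclideanSpace.single b (1 : ℂ) =
      WithLp.toLp 2 (fun b' : Fin n → Bool => ∏ i, if b' i = b i then (1 : ℂ) else 0) := by
    ext b'
    simp [Finset.prod_ite_zero, funext_iff]
  have h : inner ℂ (EuclideanSpace.single b (1 : ℂ)) u = 0 := by
    rw [hsingle, prod_eq_sum_phi (α := α) hβ fun i t => if t = b i then (1 : ℂ) else 0, sum_inner]
    exact Finset.sum_eq_zero fun x _ => by rw [inner_smul_left, hu, mul_zero]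
  rwa [EuclideanSpace.inner_single_left, map_one, one_mul] at h

/-- A vector orthogonal to `S` and to `φ_𝟎` vanishes. -/
theorem eq_zero_of_mem_hardySpan_orthogonal {n : ℕ} {α β : Fin n → ℂ} (hα : ∀ j, α j ≠ 0)
    (hβ : ∀ j, β j ≠ 0) {u : EuclideanSpace ℂ (Fin n → Bool)} (hu : u ∈ (hardySpan α β)ᗮ)
    (hzero : inner ℂ (phi α β fun _ => false) u = 0) : u = 0 := by
  rw [Submodule.mem_orthogonal] at hu
  have hne : ∀ x : Fin n → Bool, x ≠ (fun _ => true) → inner ℂ (phi α β x) u = 0 := by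
    intro x hx
    by_cases hx0 : x = fun _ => false
    · rwa [hx0]
    · exact hu _ (Submodule.subset_span (Or.inr ⟨x, hx0, hx, rfl⟩))
  refine eq_zero_of_inner_phi_eq_zero (α := α) hβ fun x => ?_
  by_cases hx : x = fun _ => true
  · have hminus : inner ℂ (phiMinus α β) u = 0 := hu _ (Submodule.subset_span (Or.inl rfl))
    have hexp : phiMinus α β = _ := prod_eq_sum_phi (α := α) hβ fun i => ketM (α i) (β i)
    rw [hexp, sum_inner, Finset.sum_eq_single x, inner_smul_left] at hminus
    · refine (mul_eq_zero.mp hminus).resolve_left ?_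
      simp [hx, ketM, Finset.prod_eq_zero_iff, hα, hβ]
    · intro y _ hy
      rw [inner_smul_left, hne y (hx ▸ hy), mul_zero]
    · simp
  · exact hne x hx

/-- The orthogonal complement of `S` is at most one-dimensional. -/
theorem exists_eq_smul_of_mem_hardySpan_orthogonal {n : ℕ} {α β : Fin n → ℂ}
    (hα : ∀ j, α j ≠ 0) (hβ : ∀ j, β j ≠ 0) {ψ w : EuclideanSpace ℂ (Fin n → Bool)}
    (hψ : ψ ∈ (hardySpan α β)ᗮ) (hψ0 : ψ ≠ 0) (hw : w ∈ (hardySpan α β)ᗮ) :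
    ∃ d : ℂ, w = d • ψ := by
  set z := phi α β fun _ => false
  have hz : inner ℂ z ψ ≠ 0 := fun h =>
    hψ0 (eq_zero_of_mem_hardySpan_orthogonal hα hβ hψ h)
  refine ⟨inner ℂ z w / inner ℂ z ψ, sub_eq_zero.mp ?_⟩
  refine eq_zero_of_mem_hardySpan_orthogonal hα hβ
    (Submodule.sub_mem _ hw (Submodule.smul_mem _ _ hψ)) ?_
  rw [inner_sub_right, inner_smul_right, div_mul_cancel₀ _ hz, sub_self]

end Hardy

/-- The columns of a Hermitian matrix are orthogonal to its kernel. -/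
theorem Matrix.IsHermitian.inner_col_eq_zero {ι : Type*} [Fintype ι] {ρ : Matrix ι ι ℂ}
    (hρ : ρ.IsHermitian) {v : EuclideanSpace ℂ ι} (hv : ρ *ᵥ v.ofLp = 0) (b : ι) :
    inner ℂ v (WithLp.toLp 2 fun a => ρ a b) = 0 := by
  have h : star (ρ *ᵥ v.ofLp) b = 0 := by simp [hv]
  rw [star_mulVec, hρ.eq] at h
  rw [EuclideanSpace.inner_eq_star_dotProduct, dotProduct_comm]
  exact h

/-- A Hermitian matrix whose columns are all multiples of a unit vector `ψ` is
`(Tr ρ) ψψᴴ`. -/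
theorem Matrix.IsHermitian.eq_trace_smul_vecMulVec {ι : Type*} [Fintype ι] {ρ : Matrix ι ι ℂ}
    (hρ : ρ.IsHermitian) {ψ d : ι → ℂ} (hψ : star ψ ⬝ᵥ ψ = 1)
    (hd : ρ = vecMulVec ψ d) : ρ = ρ.trace • vecMulVec ψ (star ψ) := by
  have hrow : star ψ ᵥ* ρ = d := by rw [hd, vecMul_vecMulVec, hψ, one_smul]
  have htrace : ρ.trace = ψ ⬝ᵥ d := by rw [hd, trace_vecMulVec]
  have hd' : d = star (ψ ⬝ᵥ d) • star ψ := by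
    have h : star ψ ᵥ* ρᴴ = d := by rw [hρ.eq, hrow]
    rw [hd, conjTranspose_vecMulVec, vecMul_vecMulVec] at h
    rw [← star_dotProduct_star, dotProduct_comm]
    exact h.symm
  have hreal : star (ψ ⬝ᵥ d) = ρ.trace := by
    rw [← htrace, ← trace_conjTranspose, hρ.eq]
  rw [hreal] at hd'
  conv_lhs => rw [hd, hd', vecMulVec_smul]

/-- **Density matrices satisfying the Hardy zero-conditions are the pure Hardy
state.** If a positive semidefinite matrix `ρ` (indexed by `Fin n → Bool`)
satisfies `vᴴ ρ v = 0` for `v = φ₋` and for every `v = φ_x` with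
`x ∉ {𝟎, 𝟏⁺}`, and `ψ` is a unit vector orthogonal to `S = hardySpan α β`,
then `ρ = c · ψψᴴ` for some real `c ≥ 0`, namely `c = Tr ρ`. -/
theorem hardy_density_matrix_rigidity (n : ℕ) (α β : Fin n → ℂ)
    (hnorm : ∀ j, ‖α j‖ ^ 2 + ‖β j‖ ^ 2 = 1)
    (hα : ∀ j, 0 < ‖α j‖ ∧ ‖α j‖ < 1)
    (ρ : Matrix (Fin n → Bool) (Fin n → Bool) ℂ) (hρ : ρ.PosSemidef)
    (hminus :
      star ((WithLp.equiv 2 _) (phiMinus α β)) ⬝ᵥ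
        ρ.mulVec ((WithLp.equiv 2 _) (phiMinus α β)) = 0)
    (hphi : ∀ x : Fin n → Bool, x ≠ (fun _ => false) → x ≠ (fun _ => true) →
      star ((WithLp.equiv 2 _) (phi α β x)) ⬝ᵥ
        ρ.mulVec ((WithLp.equiv 2 _) (phi α β x)) = 0)
    (ψ : EuclideanSpace ℂ (Fin n → Bool))
    (hψ : ‖ψ‖ = 1) (hmem : ψ ∈ (hardySpan α β)ᗮ) :
    ∃ c : ℝ, 0 ≤ c ∧ (c : ℂ) = ρ.trace ∧
      ρ = (c : ℂ) •
        Matrix.vecMulVec ((WithLp.equiv 2 _) ψ) (star ((WithLp.equiv 2 _) ψ)) := by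
  have hα0 : ∀ j, α j ≠ 0 := fun j => norm_pos_iff.mp (hα j).1
  have hβ0 : ∀ j, β j ≠ 0 := by
    intro j h
    have h1 := hnorm j
    have h2 := hα j
    rw [h, norm_zero] at h1
    nlinarith
  have hcol : ∀ b, WithLp.toLp 2 (fun a => ρ a b) ∈ (hardySpan α β)ᗮ := by
    intro b
    rw [hardySpan, Submodule.mem_orthogonal]
    intro v hv
    induction hv using Submodule.span_induction with
    | mem v hv =>
      refine hρ.isHermitian.inner_col_eq_zero ((hρ.dotProduct_mulVec_zero_iff _).mp ?_) b
      rcases hv with rfl | ⟨x, hx0, hx1, rfl⟩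
      · exact hminus
      · exact hphi x hx0 hx1
    | zero => exact inner_zero_left _
    | add v w _ _ hv hw => rw [inner_add_left, hv, hw, add_zero]
    | smul a v _ hv => rw [inner_smul_left, hv, mul_zero]
  have hψ0 : ψ ≠ 0 := norm_ne_zero_iff.mp (by rw [hψ]; exact one_ne_zero)
  choose d hd using fun b =>
    exists_eq_smul_of_mem_hardySpan_orthogonal hα0 hβ0 hmem hψ0 (hcol b)
  have hunit : star ψ.ofLp ⬝ᵥ ψ.ofLp = 1 := by
    rw [dotProduct_comm, ← EuclideanSpace.inner_eq_star_dotProduct, inner_self_eq_norm_sq_to_K, hψ]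
    simp
  have hfactor : ρ = vecMulVec ψ.ofLp d := by
    ext a b
    have h := congrArg (fun v : EuclideanSpace ℂ (Fin n → Bool) => v a) (hd b)
    simpa [vecMulVec_apply, mul_comm] using h
  obtain ⟨hre, him⟩ := Complex.nonneg_iff.mp hρ.trace_nonneg
  have htrace : ((ρ.trace.re : ℝ) : ℂ) = ρ.trace := Complex.ext rfl (by simpa using him)
  refine ⟨ρ.trace.re, hre, htrace, ?_⟩
  rw [htrace]
  exact hρ.isHermitian.eq_trace_smul_vecMulVec hunit hfactor
end
end

section
/- With the notation of the n-qubit Hardy construction (n ≥ 2): let t be the unique real number in (0,1) with ∑_{k=1}^{n} t^k = 1, and suppose a unit vector ψ ∈ H orthogonal to S attains the maximal Hardy success probability, i.e. |⟨ψ, φ_𝟎⟩|² = t^n (1−t)^n / (1 − t^n). Then |α j|² = t for every j ∈ Fin n. Consequently the optimal measurement settings are identical on all sites (U_i = U, D_i = D with α_i = α, β_i = β for all i), and ψ is, up to a phase, the unique n-qubit Hardy state |ψ^H_n⟩ associated with this symmetric optimal setting. -/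
noncomputable section

open Hardy

namespace Hardy

/-- The product vector with the single-site factors `c i`. -/
def tensorVec {n : ℕ} (c : Fin n → Bool → ℂ) : EuclideanSpace ℂ (Fin n → Bool) :=
  WithLp.toLp 2 fun b => ∏ i, c i (b i)

lemma inner_tensorVec {n : ℕ} (c d : Fin n → Bool → ℂ) :
    inner ℂ (tensorVec c) (tensorVec d) = ∏ i, ∑ b, starRingEnd ℂ (c i b) * d i b := by
  rw [Finset.prod_univ_sum, Fintype.piFinset_univ, PiLp.inner_apply]
  refine Finset.sum_congr rfl fun b _ => ?_
  simp [tensorVec, Finset.prod_mul_distrib, mul_comm]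

/-- The single-site factor `|1⟩`, the indicator of `true`. -/
def ket1 : Bool → ℂ := fun t => if t then 1 else 0

/-- The product vector `|1⟩ ⊗ ⋯ ⊗ |1⟩`. -/
def phiOnes (n : ℕ) : EuclideanSpace ℂ (Fin n → Bool) := tensorVec fun _ => ket1

lemma phi_eq_tensorVec {n : ℕ} (α β : Fin n → ℂ) (x : Fin n → Bool) :
    phi α β x = tensorVec fun i => if x i then ketP (α i) (β i) else ket0 := by
  refine PiLp.ext fun b => ?_
  change ∏ i : Fin n, _ = ∏ i : Fin n, _
  exact Finset.prod_congr rfl fun i _ => (ite_apply _ _ _ _).symm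

lemma phiMinus_eq_tensorVec {n : ℕ} (α β : Fin n → ℂ) :
    phiMinus α β = tensorVec fun i => ketM (α i) (β i) := rfl

lemma inner_phiMinus_phi {n : ℕ} (α β : Fin n → ℂ) {x : Fin n → Bool}
    (hx : x ≠ fun _ => false) : inner ℂ (phiMinus α β) (phi α β x) = 0 := by
  obtain ⟨i, hi⟩ := Function.ne_iff.1 hx
  rw [phi_eq_tensorVec, phiMinus_eq_tensorVec, inner_tensorVec]
  refine Finset.prod_eq_zero (Finset.mem_univ i) ?_
  simp only [Bool.not_eq_false] at hi
  simp [hi, ketM, ketP]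
  ring

lemma inner_phiOnes_phi {n : ℕ} (α β : Fin n → ℂ) {x : Fin n → Bool}
    (hx : x ≠ fun _ => true) : inner ℂ (phiOnes n) (phi α β x) = 0 := by
  obtain ⟨i, hi⟩ := Function.ne_iff.1 hx
  rw [phi_eq_tensorVec, phiOnes, inner_tensorVec]
  refine Finset.prod_eq_zero (Finset.mem_univ i) ?_
  simp only [Bool.not_eq_true] at hi
  simp [hi, ket1, ket0]

lemma inner_phiOnes_phi_true {n : ℕ} (α β : Fin n → ℂ) :
    inner ℂ (phiOnes n) (phi α β fun _ => true) = ∏ i, β i := by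
  rw [phi_eq_tensorVec, phiOnes, inner_tensorVec]
  simp [ket1, ketP]

lemma inner_phiMinus_phi_false {n : ℕ} (α β : Fin n → ℂ) :
    inner ℂ (phiMinus α β) (phi α β fun _ => false) = ∏ i, β i := by
  rw [phi_eq_tensorVec, phiMinus_eq_tensorVec, inner_tensorVec]
  simp [ketM, ket0]

lemma inner_phiMinus_phiOnes {n : ℕ} (α β : Fin n → ℂ) :
    inner ℂ (phiMinus α β) (phiOnes n) = ∏ i, -α i := by
  rw [phiMinus_eq_tensorVec, phiOnes, inner_tensorVec]
  simp [ketM, ket1]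

lemma inner_phiOnes_self (n : ℕ) : inner ℂ (phiOnes n) (phiOnes n) = 1 := by
  rw [phiOnes, inner_tensorVec]
  simp [ket1]

lemma inner_phiMinus_self {n : ℕ} (α β : Fin n → ℂ) (h : ∀ j, ‖α j‖ ^ 2 + ‖β j‖ ^ 2 = 1) :
    inner ℂ (phiMinus α β) (phiMinus α β) = 1 := by
  rw [phiMinus_eq_tensorVec, inner_tensorVec]
  refine Finset.prod_eq_one fun i _ => ?_
  have h' : (‖α i‖ : ℂ) ^ 2 + (‖β i‖ : ℂ) ^ 2 = 1 := by exact_mod_cast h i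
  simpa [ketM, Complex.mul_conj'] using h'

/-- The vectors `φ_x` are total. -/
lemma eq_zero_of_forall_inner_phi {n : ℕ} (α β : Fin n → ℂ) (hβ : ∀ j, β j ≠ 0)
    (w : EuclideanSpace ℂ (Fin n → Bool)) (h : ∀ x, inner ℂ (phi α β x) w = 0) : w = 0 := by
  refine PiLp.ext fun x => ?_
  induction x using WellFoundedLT.induction with
  | ind x ih =>
    have hx := h x
    rw [PiLp.inner_apply, Finset.sum_eq_single x] at hx
    · have hne : phi α β x x ≠ 0 := by
        change ∏ i : Fin n, _ ≠ 0
        refine Finset.prod_ne_zero_iff.2 fun i _ => ?_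
        cases hi : x i <;> simp [ketP, ket0, hβ]
      simpa [hne] using hx
    · intro b _ hb
      by_cases hle : b ≤ x
      · rw [ih b (lt_of_le_of_ne hle hb)]
        simp
      · obtain ⟨i, hi⟩ := not_forall.1 hle
        have hz : phi α β x b = 0 := by
          refine Finset.prod_eq_zero (Finset.mem_univ i) ?_
          cases hxi : x i <;> cases hbi : b i <;> simp_all [ket0]
        simp [hz]
    · simp

/-- The unnormalized Hardy state, the component of `|1⟩ ⊗ ⋯ ⊗ |1⟩` orthogonal to `φ₋`. -/
def hardyVec {n : ℕ} (α β : Fin n → ℂ) : EuclideanSpace ℂ (Fin n → Bool) :=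
  phiOnes n - (∏ i, -α i) • phiMinus α β

lemma inner_eq_zero_of_mem_hardySpan_orthogonal {n : ℕ} {α β : Fin n → ℂ}
    {ψ : EuclideanSpace ℂ (Fin n → Bool)} (h : ψ ∈ (hardySpan α β)ᗮ) :
    inner ℂ (phiMinus α β) ψ = 0 ∧
      ∀ x : Fin n → Bool, x ≠ (fun _ => false) → x ≠ (fun _ => true) →
        inner ℂ (phi α β x) ψ = 0 := by
  rw [Submodule.mem_orthogonal] at h
  exact ⟨h _ (Submodule.subset_span (Or.inl rfl)),
    fun x h0 h1 => h _ (Submodule.subset_span (Or.inr ⟨x, h0, h1, rfl⟩))⟩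

lemma inner_phiMinus_hardyVec {n : ℕ} (α β : Fin n → ℂ)
    (h : ∀ j, ‖α j‖ ^ 2 + ‖β j‖ ^ 2 = 1) : inner ℂ (phiMinus α β) (hardyVec α β) = 0 := by
  rw [hardyVec, inner_sub_right, inner_smul_right, inner_phiMinus_self α β h,
    inner_phiMinus_phiOnes]
  ring

lemma inner_hardyVec_phi {n : ℕ} (α β : Fin n → ℂ) {x : Fin n → Bool}
    (hx : x ≠ fun _ => false) :
    inner ℂ (hardyVec α β) (phi α β x) = inner ℂ (phiOnes n) (phi α β x) := by
  rw [hardyVec, inner_sub_left, inner_smul_left, inner_phiMinus_phi α β hx]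
  ring

lemma exists_smul_hardyVec {n : ℕ} (hn : 0 < n) (α β : Fin n → ℂ)
    (h : ∀ j, ‖α j‖ ^ 2 + ‖β j‖ ^ 2 = 1) (hβ : ∀ j, β j ≠ 0)
    {ψ : EuclideanSpace ℂ (Fin n → Bool)} (hψ : ψ ∈ (hardySpan α β)ᗮ) :
    ∃ c : ℂ, ψ = c • hardyVec α β := by
  obtain ⟨hM, hx⟩ := inner_eq_zero_of_mem_hardySpan_orthogonal hψ
  have hB : ∏ i, β i ≠ 0 := Finset.prod_ne_zero_iff.2 fun i _ => hβ i
  have htf : (fun _ : Fin n => true) ≠ fun _ => false := fun hh => by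
    simpa using congrFun hh ⟨0, hn⟩
  have hv (x : Fin n → Bool) (h0 : x ≠ fun _ => false) (h1 : x ≠ fun _ => true) :
      inner ℂ (phi α β x) (hardyVec α β) = 0 := by
    rw [← inner_conj_symm, inner_hardyVec_phi α β h0, inner_phiOnes_phi α β h1, map_zero]
  have hv1 : inner ℂ (phi α β fun _ => true) (hardyVec α β) ≠ 0 := by
    rw [← inner_conj_symm, inner_hardyVec_phi α β htf, inner_phiOnes_phi_true]
    exact (map_ne_zero _).2 hB
  have hm0 : inner ℂ (phi α β fun _ => false) (phiMinus α β) ≠ 0 := by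
    rw [← inner_conj_symm, inner_phiMinus_phi_false]
    exact (map_ne_zero _).2 hB
  have hmx (x : Fin n → Bool) (h0 : x ≠ fun _ => false) :
      inner ℂ (phi α β x) (phiMinus α β) = 0 := by
    rw [← inner_conj_symm, inner_phiMinus_phi α β h0, map_zero]
  let c : ℂ := inner ℂ (phi α β fun _ => true) ψ /
    inner ℂ (phi α β fun _ => true) (hardyVec α β)
  let d : ℂ := inner ℂ (phi α β fun _ => false) (ψ - c • hardyVec α β) /
    inner ℂ (phi α β fun _ => false) (phiMinus α β)
  have hw : ψ - c • hardyVec α β - d • phiMinus α β = 0 := by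
    refine eq_zero_of_forall_inner_phi α β hβ _ fun x => ?_
    by_cases h0 : x = fun _ => false
    · rw [h0, inner_sub_right, inner_smul_right]
      exact sub_eq_zero.2 (div_mul_cancel₀ _ hm0).symm
    · rw [inner_sub_right, inner_smul_right, hmx x h0, inner_sub_right, inner_smul_right]
      by_cases h1 : x = fun _ => true
      · rw [h1, mul_zero, sub_zero]
        exact sub_eq_zero.2 (div_mul_cancel₀ _ hv1).symm
      · rw [hx x h0 h1, hv x h0 h1]
        ring
  have hd : d = 0 := by
    have := congrArg (inner ℂ (phiMinus α β)) hw
    rwa [inner_sub_right, inner_sub_right, inner_smul_right, inner_smul_right, hM,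
      inner_phiMinus_hardyVec α β h, inner_phiMinus_self α β h, inner_zero_right, mul_zero,
      sub_zero, zero_sub, mul_one, neg_eq_zero] at this
  refine ⟨c, ?_⟩
  rwa [hd, zero_smul, sub_zero, sub_eq_zero] at hw

lemma norm_hardyVec_sq {n : ℕ} (α β : Fin n → ℂ) (h : ∀ j, ‖α j‖ ^ 2 + ‖β j‖ ^ 2 = 1) :
    ‖hardyVec α β‖ ^ 2 = 1 - ∏ i, ‖α i‖ ^ 2 := by
  have h1 : inner ℂ (hardyVec α β) (hardyVec α β) = 1 - ((∏ i, ‖α i‖ ^ 2 : ℝ) : ℂ) := by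
    conv_lhs => enter [2]; rw [hardyVec]
    rw [inner_sub_left, inner_smul_left, inner_phiMinus_hardyVec α β h, mul_zero, sub_zero,
      hardyVec, inner_sub_right, inner_smul_right, inner_phiOnes_self,
      ← inner_conj_symm (phiOnes n), inner_phiMinus_phiOnes, Complex.mul_conj']
    push_cast
    simp [norm_prod, Finset.prod_pow]
  rw [← inner_self_eq_norm_sq (𝕜 := ℂ), h1, ← Complex.ofReal_one, ← Complex.ofReal_sub]
  exact Complex.ofReal_re _

lemma norm_inner_hardyVec_phi_false_sq {n : ℕ} (hn : 0 < n) (α β : Fin n → ℂ) :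
    ‖inner ℂ (hardyVec α β) (phi α β fun _ => false)‖ ^ 2 =
      (∏ i, ‖α i‖ ^ 2) * ∏ i, ‖β i‖ ^ 2 := by
  have hft : (fun _ : Fin n => false) ≠ fun _ => true := fun hh => by
    simpa using congrFun hh ⟨0, hn⟩
  rw [hardyVec, inner_sub_left, inner_smul_left, inner_phiOnes_phi α β hft,
    inner_phiMinus_phi_false]
  simp [norm_prod, Finset.prod_pow, mul_pow]

/-- Gibbs' inequality for two Bernoulli distributions. -/
lemma gibbs_le {a s : ℝ} (ha : a ∈ Set.Ioo (0 : ℝ) 1) (hs : s ∈ Set.Ioo (0 : ℝ) 1) :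
    s * (Real.log a - Real.log s) + (1 - s) * (Real.log (1 - a) - Real.log (1 - s)) ≤ 0 := by
  obtain ⟨ha0, ha1⟩ := ha
  obtain ⟨hs0, hs1⟩ := hs
  rw [← sub_pos] at ha1 hs1
  rw [← Real.log_div ha0.ne' hs0.ne', ← Real.log_div ha1.ne' hs1.ne']
  have h1 := mul_le_mul_of_nonneg_left (Real.log_le_sub_one_of_pos (div_pos ha0 hs0)) hs0.le
  have h2 := mul_le_mul_of_nonneg_left (Real.log_le_sub_one_of_pos (div_pos ha1 hs1)) hs1.le
  rw [mul_sub, mul_div_cancel₀ _ hs0.ne'] at h1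
  rw [mul_sub, mul_div_cancel₀ _ hs1.ne'] at h2
  linarith

lemma gibbs_lt {a s : ℝ} (ha : a ∈ Set.Ioo (0 : ℝ) 1) (hs : s ∈ Set.Ioo (0 : ℝ) 1)
    (has : a ≠ s) :
    s * (Real.log a - Real.log s) + (1 - s) * (Real.log (1 - a) - Real.log (1 - s)) < 0 := by
  obtain ⟨ha0, ha1⟩ := ha
  obtain ⟨hs0, hs1⟩ := hs
  rw [← sub_pos] at ha1 hs1
  rw [← Real.log_div ha0.ne' hs0.ne', ← Real.log_div ha1.ne' hs1.ne']
  have hne : a / s ≠ 1 := fun h => has ((div_eq_one_iff_eq hs0.ne').1 h)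
  have h1 := mul_lt_mul_of_pos_left (Real.log_lt_sub_one_of_pos (div_pos ha0 hs0) hne) hs0
  have h2 := mul_le_mul_of_nonneg_left (Real.log_le_sub_one_of_pos (div_pos ha1 hs1)) hs1.le
  rw [mul_sub, mul_div_cancel₀ _ hs0.ne'] at h1
  rw [mul_sub, mul_div_cancel₀ _ hs1.ne'] at h2
  linarith

/-- With a fixed mean of `log a i`, the sum of `log (1 - a i)` is largest for equal `a i`. -/
lemma sum_log_one_sub_le {ι : Type*} [Fintype ι] {a : ι → ℝ} {s : ℝ}
    (ha : ∀ i, a i ∈ Set.Ioo (0 : ℝ) 1) (hs : s ∈ Set.Ioo (0 : ℝ) 1)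
    (hmean : ∑ i, Real.log (a i) = Fintype.card ι * Real.log s) :
    ∑ i, Real.log (1 - a i) ≤ Fintype.card ι * Real.log (1 - s) ∧
      (∑ i, Real.log (1 - a i) = Fintype.card ι * Real.log (1 - s) → ∀ i, a i = s) := by
  have hsum : ∑ i, (s * (Real.log (a i) - Real.log s) +
      (1 - s) * (Real.log (1 - a i) - Real.log (1 - s))) =
      (1 - s) * (∑ i, Real.log (1 - a i) - Fintype.card ι * Real.log (1 - s)) := by
    simp [Finset.sum_add_distrib, ← Finset.mul_sum, Finset.sum_sub_distrib, hmean]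
  have hle := Finset.sum_nonpos fun i (_ : i ∈ Finset.univ) => gibbs_le (ha i) hs
  refine ⟨?_, fun heq i => ?_⟩
  · rw [hsum] at hle
    exact sub_nonpos.1 (nonpos_of_mul_nonpos_right hle (sub_pos.2 hs.2))
  · by_contra hne
    have hlt := Finset.sum_lt_sum (fun i (_ : i ∈ Finset.univ) => gibbs_le (ha i) hs)
      ⟨i, Finset.mem_univ i, gibbs_lt (ha i) hs hne⟩
    rw [hsum, heq] at hlt
    simp at hlt

lemma one_sub_mul_sum_range (n : ℕ) (t : ℝ) :
    (1 - t) * ∑ k ∈ Finset.range n, ((n : ℝ) - k) * t ^ (k + 1) =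
      n * t - t * ∑ k ∈ Finset.range n, t ^ (k + 1) := by
  induction n with
  | zero => simp
  | succ n ih =>
    have h1 : ∑ k ∈ Finset.range n, (((n + 1 : ℕ) : ℝ) - k) * t ^ (k + 1) =
        ∑ k ∈ Finset.range n, ((n : ℝ) - k) * t ^ (k + 1) +
          ∑ k ∈ Finset.range n, t ^ (k + 1) := by
      rw [← Finset.sum_add_distrib]
      refine Finset.sum_congr rfl fun k _ => ?_
      push_cast
      ring
    have h2 := mul_neg_geom_sum t n
    have h3 : ∑ k ∈ Finset.range n, t ^ (k + 1) = t * ∑ k ∈ Finset.range n, t ^ k := by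
      rw [Finset.mul_sum]
      exact Finset.sum_congr rfl fun k _ => pow_succ' t k
    rw [Finset.sum_range_succ, Finset.sum_range_succ, h1, mul_add, mul_add, ih, h3]
    push_cast
    linear_combination t * h2

/-- The logarithm of the Hardy success probability at the symmetric setting `s`. -/
def logProb (n : ℕ) (s : ℝ) : ℝ :=
  n * Real.log s + n * Real.log (1 - s) - Real.log (1 - s ^ n)

lemma logProb_eq {n : ℕ} (hn : 0 < n) {s : ℝ} (hs : s ∈ Set.Ioo (0 : ℝ) 1) :
    logProb n s = n * Real.log s + (n - 1) * Real.log (1 - s) -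
      Real.log (∑ k ∈ Finset.range n, s ^ k) := by
  have hpos : 0 < ∑ k ∈ Finset.range n, s ^ k :=
    Finset.sum_pos (fun k _ => pow_pos hs.1 k) (Finset.nonempty_range_iff.2 hn.ne')
  rw [logProb, ← mul_neg_geom_sum, Real.log_mul (sub_pos.2 hs.2).ne' hpos.ne']
  ring

lemma logProb_lt {n : ℕ} (hn : 2 ≤ n) {t s : ℝ} (ht : t ∈ Set.Ioo (0 : ℝ) 1)
    (hs : s ∈ Set.Ioo (0 : ℝ) 1) (htsum : ∑ k ∈ Finset.range n, t ^ (k + 1) = 1)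
    (hst : s ≠ t) : logProb n s < logProb n t := by
  have hn0 : 0 < n := by omega
  set D := Real.log s - Real.log t with hD
  set c := ∑ k ∈ Finset.range n, (k : ℝ) * t ^ (k + 1) with hc
  have hsum_t : t * ∑ k ∈ Finset.range n, t ^ k = 1 := by
    rw [← htsum, Finset.mul_sum]
    exact Finset.sum_congr rfl fun k _ => (pow_succ' t k).symm
  have hsexp : s = t * Real.exp D := by
    rw [hD, Real.exp_sub, Real.exp_log hs.1, Real.exp_log ht.1, mul_div_cancel₀ _ ht.1.ne']
  have hjensen : Real.exp (c * D) ≤ t * ∑ k ∈ Finset.range n, s ^ k := by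
    have hone : 1 = ∑ k ∈ Finset.range n, t ^ (k + 1) * (k * D - c * D + 1) := by
      have : ∀ k : ℕ, t ^ (k + 1) * (k * D - c * D + 1) =
          D * (k * t ^ (k + 1)) + (1 - c * D) * t ^ (k + 1) := fun k => by ring
      simp only [this, Finset.sum_add_distrib, ← Finset.mul_sum, htsum, ← hc]
      ring
    calc Real.exp (c * D)
        = Real.exp (c * D) * ∑ k ∈ Finset.range n, t ^ (k + 1) * (k * D - c * D + 1) := by
          rw [← hone, mul_one]
      _ ≤ Real.exp (c * D) * ∑ k ∈ Finset.range n, t ^ (k + 1) * Real.exp (k * D - c * D) := by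
          gcongr with k _
          · exact pow_nonneg ht.1.le _
          · exact Real.add_one_le_exp _
      _ = t * ∑ k ∈ Finset.range n, s ^ k := by
          rw [Finset.mul_sum, Finset.mul_sum]
          refine Finset.sum_congr rfl fun k _ => ?_
          rw [Real.exp_sub, hsexp, mul_pow, ← Real.exp_nat_mul]
          field_simp
          ring
  have hpos_s : 0 < ∑ k ∈ Finset.range n, s ^ k :=
    Finset.sum_pos (fun k _ => pow_pos hs.1 k) (Finset.nonempty_range_iff.2 hn0.ne')
  have hlog_s : c * D ≤ Real.log t + Real.log (∑ k ∈ Finset.range n, s ^ k) := by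
    rw [← Real.log_mul ht.1.ne' hpos_s.ne']
    exact (Real.le_log_iff_exp_le (mul_pos ht.1 hpos_s)).2 hjensen
  have hlog_t : Real.log (∑ k ∈ Finset.range n, t ^ k) = -Real.log t := by
    rw [← Real.log_inv, eq_inv_of_mul_eq_one_right hsum_t]
  have hcoef : (1 - t) * (n - c) = (n - 1) * t := by
    have h1 := one_sub_mul_sum_range n t
    simp only [sub_mul (n : ℝ), Finset.sum_sub_distrib, ← Finset.mul_sum, htsum, ← hc] at h1
    linear_combination h1
  have hn1 : (0 : ℝ) < n - 1 := by
    have : (2 : ℝ) ≤ n := by exact_mod_cast hn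
    linarith
  have hg := mul_neg_of_pos_of_neg hn1 (gibbs_lt hs ht hst)
  have hg' : (1 - t) * ((n - c) * D + (n - 1) * (Real.log (1 - s) - Real.log (1 - t))) < 0 := by
    have : (1 - t) * ((n - c) * D + (n - 1) * (Real.log (1 - s) - Real.log (1 - t))) =
        (n - 1) * (t * D + (1 - t) * (Real.log (1 - s) - Real.log (1 - t))) := by
      linear_combination D * hcoef
    rwa [this]
  have hneg := neg_of_mul_neg_right hg' (sub_pos.2 ht.2).le
  rw [logProb_eq hn0 hs, logProb_eq hn0 ht, hlog_t]
  linarith [hD ▸ hlog_s, hD ▸ hneg]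

/-- The Hardy success probability is maximal only at the symmetric setting `t`. -/
lemma eq_of_prod_div_eq {n : ℕ} (hn : 2 ≤ n) {t : ℝ} (ht : t ∈ Set.Ioo (0 : ℝ) 1)
    (htsum : ∑ k ∈ Finset.range n, t ^ (k + 1) = 1) {a : Fin n → ℝ}
    (ha : ∀ i, a i ∈ Set.Ioo (0 : ℝ) 1)
    (h : (∏ i, a i) * (∏ i, (1 - a i)) / (1 - ∏ i, a i) = t ^ n * (1 - t) ^ n / (1 - t ^ n)) :
    ∀ i, a i = t := by
  have hn0 : (n : ℝ) ≠ 0 := by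
    have : n ≠ 0 := by omega
    exact_mod_cast this
  have hlog : ∑ i, Real.log (a i) < 0 :=
    Finset.sum_neg (fun i _ => Real.log_neg (ha i).1 (ha i).2) ⟨⟨0, by omega⟩, Finset.mem_univ _⟩
  set s := Real.exp ((∑ i, Real.log (a i)) / n) with hs_def
  have hs : s ∈ Set.Ioo (0 : ℝ) 1 :=
    ⟨Real.exp_pos _, Real.exp_lt_one_iff.2 (div_neg_of_neg_of_pos hlog (by positivity))⟩
  have hmean : ∑ i, Real.log (a i) = n * Real.log s := by
    rw [hs_def, Real.log_exp, mul_div_cancel₀ _ hn0]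
  have hprod : ∏ i, a i = s ^ n := by
    rw [hs_def, ← Real.exp_nat_mul, mul_div_cancel₀ _ hn0, Real.exp_sum]
    exact Finset.prod_congr rfl fun i _ => (Real.exp_log (ha i).1).symm
  have hpow {r : ℝ} (hr : r ∈ Set.Ioo (0 : ℝ) 1) : 1 - r ^ n ≠ 0 :=
    (sub_pos.2 (pow_lt_one₀ hr.1.le hr.2 (by omega))).ne'
  have hs1 : ∀ i, 1 - a i ≠ 0 := fun i => (sub_pos.2 (ha i).2).ne'
  have hlogs : n * Real.log s + ∑ i, Real.log (1 - a i) - Real.log (1 - s ^ n) =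
      logProb n t := by
    have h' := congrArg Real.log h
    rw [hprod, Real.log_div (mul_ne_zero (pow_ne_zero _ hs.1.ne')
        (Finset.prod_ne_zero_iff.2 fun i _ => hs1 i)) (hpow hs),
      Real.log_mul (pow_ne_zero _ hs.1.ne') (Finset.prod_ne_zero_iff.2 fun i _ => hs1 i),
      Real.log_prod (fun i _ => hs1 i),
      Real.log_div (mul_ne_zero (pow_ne_zero _ ht.1.ne')
        (pow_ne_zero _ (sub_pos.2 ht.2).ne')) (hpow ht),
      Real.log_mul (pow_ne_zero _ ht.1.ne') (pow_ne_zero _ (sub_pos.2 ht.2).ne'),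
      Real.log_pow, Real.log_pow, Real.log_pow] at h'
    exact h'
  obtain ⟨hle, heq⟩ := sum_log_one_sub_le ha hs (by simpa using hmean)
  rw [Fintype.card_fin] at hle heq
  have hst : s = t := by
    by_contra hne
    have hlt := logProb_lt hn ht hs htsum hne
    rw [logProb] at hlt
    linarith
  intro i
  rw [heq _ i, hst]
  rw [logProb, ← hst] at hlogs
  linarith

end Hardy

/-- **Rigidity at the maximal Hardy probability (qubit level of Theorem 1).**
Let `n ≥ 2` and let `t` be the unique number in `(0,1)` with
`∑_{k=1}^n t^k = 1`.  If a unit vector `ψ` orthogonal to `S = hardySpan α β`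
attains the maximal Hardy success probability
`|⟨ψ, φ_𝟎⟩|² = tⁿ(1−t)ⁿ/(1−tⁿ)`, then `|α j|² = t` for every `j` (so the
optimal measurement settings are identical on all sites), and any unit vector
orthogonal to `S` equals `ψ` up to a complex phase: `ψ` is, up to a phase, the
unique `n`-qubit Hardy state for this symmetric optimal setting. -/
theorem hardy_rigidity_at_maximum (n : ℕ) (hn : 2 ≤ n)
    (t : ℝ) (ht : t ∈ Set.Ioo (0 : ℝ) 1)
    (htsum : ∑ k ∈ Finset.Icc 1 n, t ^ k = 1)
    (α β : Fin n → ℂ)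
    (hnorm : ∀ j, ‖α j‖ ^ 2 + ‖β j‖ ^ 2 = 1)
    (hα : ∀ j, 0 < ‖α j‖ ∧ ‖α j‖ < 1)
    (ψ : EuclideanSpace ℂ (Fin n → Bool))
    (hψ : ‖ψ‖ = 1) (hmem : ψ ∈ (hardySpan α β)ᗮ)
    (hmax : ‖(inner ℂ ψ (phi α β fun _ => false) : ℂ)‖ ^ 2 =
      t ^ n * (1 - t) ^ n / (1 - t ^ n)) :
    (∀ j, ‖α j‖ ^ 2 = t) ∧
      ∀ ψ' : EuclideanSpace ℂ (Fin n → Bool),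
        ‖ψ'‖ = 1 → ψ' ∈ (hardySpan α β)ᗮ →
          ∃ c : ℂ, ‖c‖ = 1 ∧ ψ' = c • ψ := by
  have hn0 : 0 < n := by omega
  have hβ_sq : ∀ j, ‖β j‖ ^ 2 = 1 - ‖α j‖ ^ 2 := fun j => by linarith [hnorm j]
  have ha : ∀ j, ‖α j‖ ^ 2 ∈ Set.Ioo (0 : ℝ) 1 := fun j =>
    ⟨pow_pos (hα j).1 2, pow_lt_one₀ (hα j).1.le (hα j).2 two_ne_zero⟩
  have hβ : ∀ j, β j ≠ 0 := fun j hj => by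
    have := hβ_sq j
    rw [hj, norm_zero] at this
    linarith [(ha j).2]
  obtain ⟨c, hc⟩ := exists_smul_hardyVec hn0 α β hnorm hβ hmem
  have hunit : ‖c‖ * ‖hardyVec α β‖ = 1 := by rw [← norm_smul, ← hc, hψ]
  refine ⟨?_, fun ψ' hψ' hmem' => ?_⟩
  · have hsum : ∑ k ∈ Finset.range n, t ^ (k + 1) = 1 := by
      rw [← htsum, Finset.range_eq_Ico, Finset.sum_Ico_add' (fun k => t ^ k) 0 n 1]
      rfl
    refine eq_of_prod_div_eq hn ht hsum ha ?_
    have hv0 : ‖hardyVec α β‖ ≠ 0 := right_ne_zero_of_mul_eq_one hunit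
    rw [← hmax, hc, inner_smul_left, norm_mul, mul_pow, norm_inner_hardyVec_phi_false_sq hn0,
      RCLike.norm_conj, eq_div_of_mul_eq hv0 hunit, ← norm_hardyVec_sq α β hnorm]
    simp only [hβ_sq]
    ring
  · obtain ⟨c', hc'⟩ := exists_smul_hardyVec hn0 α β hnorm hβ hmem'
    have hunit' : ‖c'‖ * ‖hardyVec α β‖ = 1 := by rw [← norm_smul, ← hc', hψ']
    have hv0 : ‖hardyVec α β‖ ≠ 0 := right_ne_zero_of_mul_eq_one hunit
    have hc0 : c ≠ 0 := norm_ne_zero_iff.1 (left_ne_zero_of_mul_eq_one hunit)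
    refine ⟨c' / c, ?_, ?_⟩
    · rw [norm_div, mul_right_cancel₀ hv0 (hunit'.trans hunit.symm),
        div_self (norm_ne_zero_iff.2 hc0)]
    · rw [hc', hc, smul_smul, div_mul_cancel₀ _ hc0]
end
end
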